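/- Suppose (u, v, b, p) is a smooth solution of the Eady–Boussinesq vertical slice equations on Ω for t in an open interval I. Then the out-of-slice kinetic energy K_v is differentiable on I and dK_v/dt (t) = −ρ₀ f ∫_Ω u₁ v dx dz − ρ₀ b̄_y ∫_Ω v (z − H/2) dx dz for every t ∈ I. -/

import Mathlib

open MeasureTheory

/-- Partial derivative in the `x`-direction of a scalar field on the vertical slice. -/
noncomputable def pdx (g : ℝ × ℝ → ℝ) (p : ℝ × ℝ) : ℝ := fderiv ℝ g p (1, 0)

/-- Partial derivative in the `z`-direction of a scalar field on the vertical slice. -/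
noncomputable def pdz (g : ℝ × ℝ → ℝ) (p : ℝ × ℝ) : ℝ := fderiv ℝ g p (0, 1)

/-- The vertical slice domain `Ω = [−L, L] × [0, H]`. -/
def Omega (L H : ℝ) : Set (ℝ × ℝ) := Set.Icc (-L, 0) (L, H)

/-- A smooth solution of the Eady–Boussinesq vertical slice equations on `Ω = [−L,L]×[0,H]`
for times `t ∈ I`, with constants `ρ₀` (reference density), `f` (Coriolis parameter),
`N2` (squared Brunt–Väisälä frequency) and `bY = ∂b̄/∂y` (constant background buoyancy
gradient).  All fields are smooth, `2L`-periodic in `x`, and the in-slice velocity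
satisfies the rigid-lid conditions `u₂ = 0` at `z = 0` and `z = H`. -/
structure EadySolution (L H ρ₀ f N2 bY : ℝ) (I : Set ℝ) where
  /-- in-slice velocity `u = (u₁, u₂)`, a function of time and of the point `(x, z)` -/
  u : ℝ → ℝ × ℝ → ℝ × ℝ
  /-- out-of-slice velocity `v` -/
  v : ℝ → ℝ × ℝ → ℝ
  /-- buoyancy `b` -/
  b : ℝ → ℝ × ℝ → ℝ
  /-- pressure `p` -/
  p : ℝ → ℝ × ℝ → ℝ
  smooth_u : ContDiff ℝ (⊤ : ℕ∞) fun q : ℝ × (ℝ × ℝ) => u q.1 q.2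
  smooth_v : ContDiff ℝ (⊤ : ℕ∞) fun q : ℝ × (ℝ × ℝ) => v q.1 q.2
  smooth_b : ContDiff ℝ (⊤ : ℕ∞) fun q : ℝ × (ℝ × ℝ) => b q.1 q.2
  smooth_p : ContDiff ℝ (⊤ : ℕ∞) fun q : ℝ × (ℝ × ℝ) => p q.1 q.2
  periodic_u : ∀ t x z : ℝ, u t (x + 2 * L, z) = u t (x, z)
  periodic_v : ∀ t x z : ℝ, v t (x + 2 * L, z) = v t (x, z)
  periodic_b : ∀ t x z : ℝ, b t (x + 2 * L, z) = b t (x, z)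
  periodic_p : ∀ t x z : ℝ, p t (x + 2 * L, z) = p t (x, z)
  /-- rigid lid on the lower boundary: `u·ẑ = 0` at `z = 0` -/
  rigid_bot : ∀ t x : ℝ, (u t (x, 0)).2 = 0
  /-- rigid lid on the upper boundary: `u·ẑ = 0` at `z = H` -/
  rigid_top : ∀ t x : ℝ, (u t (x, H)).2 = 0
  /-- `x̂`-component of `∂u/∂t + (u·∇)u − f v x̂ = −(1/ρ₀)∇p + b ẑ` -/
  mom_x : ∀ t ∈ I, ∀ pt ∈ Omega L H,
    deriv (fun s => (u s pt).1) t
      + (u t pt).1 * pdx (fun q => (u t q).1) pt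
      + (u t pt).2 * pdz (fun q => (u t q).1) pt
      - f * v t pt
    = -(1 / ρ₀) * pdx (p t) pt
  /-- `ẑ`-component of `∂u/∂t + (u·∇)u − f v x̂ = −(1/ρ₀)∇p + b ẑ` -/
  mom_z : ∀ t ∈ I, ∀ pt ∈ Omega L H,
    deriv (fun s => (u s pt).2) t
      + (u t pt).1 * pdx (fun q => (u t q).2) pt
      + (u t pt).2 * pdz (fun q => (u t q).2) pt
    = -(1 / ρ₀) * pdz (p t) pt + b t pt
  /-- `∂v/∂t + u·∇v + f u₁ = −b̄_y (z − H/2)` -/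
  mom_v : ∀ t ∈ I, ∀ pt ∈ Omega L H,
    deriv (fun s => v s pt) t
      + (u t pt).1 * pdx (v t) pt + (u t pt).2 * pdz (v t) pt
      + f * (u t pt).1
    = -bY * (pt.2 - H / 2)
  /-- `∂b/∂t + u·∇b + b̄_y v + N² u₂ = 0` -/
  buoy : ∀ t ∈ I, ∀ pt ∈ Omega L H,
    deriv (fun s => b s pt) t
      + (u t pt).1 * pdx (b t) pt + (u t pt).2 * pdz (b t) pt
      + bY * v t pt + N2 * (u t pt).2
    = 0
  /-- incompressibility `∇·u = 0` -/
  incomp : ∀ t ∈ I, ∀ pt ∈ Omega L H,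
    pdx (fun q => (u t q).1) pt + pdz (fun q => (u t q).2) pt = 0

/-- In-slice kinetic energy `K_u(t) = ρ₀ ∫_Ω ½|u|² dx dz`. -/
noncomputable def Ku (L H ρ₀ : ℝ) (u : ℝ → ℝ × ℝ → ℝ × ℝ) (t : ℝ) : ℝ :=
  ρ₀ * ∫ pt in Omega L H, (1 / 2) * ((u t pt).1 ^ 2 + (u t pt).2 ^ 2)

/-- Out-of-slice kinetic energy `K_v(t) = ρ₀ ∫_Ω ½ v² dx dz`. -/
noncomputable def Kv (L H ρ₀ : ℝ) (v : ℝ → ℝ × ℝ → ℝ) (t : ℝ) : ℝ :=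
  ρ₀ * ∫ pt in Omega L H, (1 / 2) * (v t pt) ^ 2

/-- Potential energy `P(t) = −ρ₀ ∫_Ω b (z − H/2) dx dz`. -/
noncomputable def Pe (L H ρ₀ : ℝ) (b : ℝ → ℝ × ℝ → ℝ) (t : ℝ) : ℝ :=
  -(ρ₀ * ∫ pt in Omega L H, b t pt * (pt.2 - H / 2))

/-- Differentiation under the integral sign over a compact set, for a `C¹` integrand. -/
theorem hasDerivAt_setIntegral_of_contDiff {E : Type*} [NormedAddCommGroup E] [NormedSpace ℝ E]
    [MeasurableSpace E] [BorelSpace E] {μ : Measure E} [IsFiniteMeasureOnCompacts μ]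
    {F : ℝ → E → ℝ} (hF : ContDiff ℝ 1 fun q : ℝ × E => F q.1 q.2) {K : Set E}
    (hK : IsCompact K) (t : ℝ) :
    HasDerivAt (fun s => ∫ x in K, F s x ∂μ) (∫ x in K, deriv (fun s => F s x) t ∂μ) t := by
  have hderiv (s : ℝ) (x : E) :
      HasDerivAt (fun r => F r x) (fderiv ℝ (fun q : ℝ × E => F q.1 q.2) (s, x) (1, 0)) s :=
    HasFDerivAt.comp_hasDerivAt (f := fun r => (r, x)) s
      (hF.differentiable one_ne_zero (s, x)).hasFDerivAt
      ((hasDerivAt_id' s).prodMk (hasDerivAt_const s x))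
  have hcont : Continuous fun q : ℝ × E => deriv (fun r => F r q.2) q.1 := by
    simp only [fun s x => (hderiv s x).deriv]
    exact (hF.continuous_fderiv one_ne_zero).clm_apply continuous_const
  obtain ⟨C, hC⟩ := ((isCompact_closedBall t 1).prod hK).exists_bound_of_continuousOn
    hcont.continuousOn
  have hslice (s : ℝ) : Continuous (F s) := hF.continuous.comp (by fun_prop : Continuous (s, ·))
  have hslice' : Continuous fun x => deriv (fun s => F s x) t :=
    hcont.comp (by fun_prop : Continuous (t, ·))
  refine (hasDerivAt_integral_of_dominated_loc_of_deriv_le (bound := fun _ => C)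
    (F' := fun s x => deriv (fun r => F r x) s) (Metric.closedBall_mem_nhds t one_pos)
    (.of_forall fun s => ((hslice s).continuousOn.integrableOn_compact hK).aestronglyMeasurable)
    ((hslice t).continuousOn.integrableOn_compact hK)
    (hslice'.continuousOn.integrableOn_compact hK).aestronglyMeasurable ?_
    (integrableOn_const hK.measure_ne_top) ?_).2
  · exact ae_restrict_of_forall_mem hK.measurableSet fun x hx s hs => hC (s, x) ⟨hs, hx⟩
  · exact .of_forall fun x s _ => (hderiv s x).differentiableAt.hasDerivAt

/-- The transport of a `C¹` scalar `w` by a divergence-free `C¹` velocity field `U` does not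
change `∫ w² / 2`, when both are periodic in `x` and `U` is tangent to the horizontal
boundaries. -/
theorem integral_mul_advection_eq_zero {L H : ℝ} (hL : 0 ≤ L) (hH : 0 ≤ H)
    {U : ℝ × ℝ → ℝ × ℝ} {w : ℝ × ℝ → ℝ} (hU : ContDiff ℝ 1 U) (hw : ContDiff ℝ 1 w)
    (hUper : ∀ x z : ℝ, U (x + 2 * L, z) = U (x, z))
    (hwper : ∀ x z : ℝ, w (x + 2 * L, z) = w (x, z))
    (hbot : ∀ x : ℝ, (U (x, 0)).2 = 0) (htop : ∀ x : ℝ, (U (x, H)).2 = 0)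
    (hdiv : ∀ q ∈ Omega L H, pdx (fun q => (U q).1) q + pdz (fun q => (U q).2) q = 0) :
    ∫ q in Omega L H, w q * ((U q).1 * pdx w q + (U q).2 * pdz w q) = 0 := by
  have h1 : ContDiff ℝ 1 fun q => (U q).1 := hU.fst
  have h2 : ContDiff ℝ 1 fun q => (U q).2 := hU.snd
  have hF : ContDiff ℝ 1 fun q => (U q).1 * (w q ^ 2 / 2) := by fun_prop
  have hG : ContDiff ℝ 1 fun q => (U q).2 * (w q ^ 2 / 2) := by fun_prop
  have hsq (q : ℝ × ℝ) : HasFDerivAt (fun q => w q ^ 2 / 2) (w q • fderiv ℝ w q) q := by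
    have h := ((hw.differentiable one_ne_zero q).hasFDerivAt.pow 2).mul_const (1 / 2 : ℝ)
    convert! h using 1
    · ext q; simp [div_eq_mul_inv]
    · ext <;> simp <;> ring
  have hF' (q : ℝ × ℝ) : HasFDerivAt (fun q => (U q).1 * (w q ^ 2 / 2)) _ q :=
    (h1.differentiable one_ne_zero q).hasFDerivAt.mul (hsq q)
  have hG' (q : ℝ × ℝ) : HasFDerivAt (fun q => (U q).2 * (w q ^ 2 / 2)) _ q :=
    (h2.differentiable one_ne_zero q).hasFDerivAt.mul (hsq q)
  have key := integral_divergence_prod_Icc_of_hasFDerivAt_of_le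
    (fun q => (U q).1 * (w q ^ 2 / 2)) (fun q => (U q).2 * (w q ^ 2 / 2))
    (fderiv ℝ fun q => (U q).1 * (w q ^ 2 / 2)) (fderiv ℝ fun q => (U q).2 * (w q ^ 2 / 2))
    (-L, 0) (L, H) ⟨by simp; linarith, hH⟩ hF.continuous.continuousOn hG.continuous.continuousOn
    (fun q _ => (hF.differentiable one_ne_zero q).hasFDerivAt)
    (fun q _ => (hG.differentiable one_ne_zero q).hasFDerivAt)
    ((((hF.continuous_fderiv one_ne_zero).clm_apply continuous_const).add
      ((hG.continuous_fderiv one_ne_zero).clm_apply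
        continuous_const)).continuousOn.integrableOn_compact isCompact_Icc)
  have hLper (z : ℝ) : U (L, z) = U (-L, z) ∧ w (L, z) = w (-L, z) := by
    have hx : -L + 2 * L = L := by ring
    exact ⟨by simpa only [hx] using hUper (-L) z, by simpa only [hx] using hwper (-L) z⟩
  simp only [hbot, htop, (hLper _).1, (hLper _).2, zero_mul, intervalIntegral.integral_zero,
    sub_self, zero_add] at key
  rw [← key]
  refine setIntegral_congr_fun measurableSet_Icc fun q hq => ?_
  have hq' := hdiv q hq
  simp only [pdx, pdz] at hq' ⊢
  simp only [(hF' q).fderiv, (hG' q).fderiv, add_apply,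
    smul_apply, smul_eq_mul]
  linear_combination -(w q ^ 2 / 2) * hq'

/-- For a smooth solution of the Eady–Boussinesq vertical slice equations on `Ω` for `t` in
an open interval `I = (a, c)`, the out-of-slice kinetic energy `K_v` is differentiable on
`I` with `dK_v/dt (t) = −ρ₀ f ∫_Ω u₁ v dx dz − ρ₀ b̄_y ∫_Ω v (z − H/2) dx dz`
for every `t ∈ I`. -/
theorem Kv_hasDerivAt (L H ρ₀ f N2 bY a c : ℝ) (hL : 0 < L) (hH : 0 < H) (hρ : 0 < ρ₀)
    (sol : EadySolution L H ρ₀ f N2 bY (Set.Ioo a c)) :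
    ∀ t ∈ Set.Ioo a c,
      HasDerivAt (Kv L H ρ₀ sol.v)
        (-(ρ₀ * f) * (∫ pt in Omega L H, (sol.u t pt).1 * sol.v t pt)
          - ρ₀ * bY * ∫ pt in Omega L H, sol.v t pt * (pt.2 - H / 2)) t := by
  intro t ht
  have hK : IsCompact (Omega L H) := isCompact_Icc
  have hΩ : MeasurableSet (Omega L H) := measurableSet_Icc
  have hu : ContDiff ℝ 1 fun q : ℝ × (ℝ × ℝ) => sol.u q.1 q.2 :=
    sol.smooth_u.of_le (by exact_mod_cast le_top)
  have hv : ContDiff ℝ 1 fun q : ℝ × (ℝ × ℝ) => sol.v q.1 q.2 :=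
    sol.smooth_v.of_le (by exact_mod_cast le_top)
  have hut : ContDiff ℝ 1 (sol.u t) := hu.comp (contDiff_prodMk_right t)
  have hvt : ContDiff ℝ 1 (sol.v t) := hv.comp (contDiff_prodMk_right t)
  have hadv := integral_mul_advection_eq_zero hL.le hH.le hut hvt (sol.periodic_u t)
    (sol.periodic_v t) (sol.rigid_bot t) (sol.rigid_top t) (sol.incomp t ht)
  have hmain := (hasDerivAt_setIntegral_of_contDiff (μ := volume)
    (F := fun s q => 1 / 2 * sol.v s q ^ 2) (by fun_prop) hK t).const_mul ρ₀
  have hdv (q : ℝ × ℝ) : DifferentiableAt ℝ (fun s => sol.v s q) t :=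
    (hv.comp (contDiff_prodMk_left q)).differentiable one_ne_zero t
  have hderiv (q : ℝ × ℝ) : deriv (fun s => 1 / 2 * sol.v s q ^ 2) t
      = sol.v t q * deriv (fun s => sol.v s q) t :=
    (((hdv q).hasDerivAt.pow 2).const_mul (1 / 2)).deriv.trans (by ring)
  have hcu : Continuous (sol.u t) := hut.continuous
  have hcv : Continuous (sol.v t) := hvt.continuous
  have hcx : Continuous (pdx (sol.v t)) :=
    (hvt.continuous_fderiv one_ne_zero).clm_apply continuous_const
  have hcz : Continuous (pdz (sol.v t)) :=
    (hvt.continuous_fderiv one_ne_zero).clm_apply continuous_const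
  have hint {g : ℝ × ℝ → ℝ} (hg : Continuous g) : IntegrableOn g (Omega L H) :=
    hg.continuousOn.integrableOn_compact hK
  convert! hmain using 1
  have hsplit : ∫ q in Omega L H, deriv (fun s => 1 / 2 * sol.v s q ^ 2) t
      = ∫ q in Omega L H, (-f * ((sol.u t q).1 * sol.v t q) - bY * (sol.v t q * (q.2 - H / 2))
        - sol.v t q * ((sol.u t q).1 * pdx (sol.v t) q + (sol.u t q).2 * pdz (sol.v t) q)) := by
    refine setIntegral_congr_fun hΩ fun q hq => ?_
    simp only [hderiv]
    linear_combination sol.v t q * sol.mom_v t ht q hq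
  rw [hsplit, integral_sub (hint (by fun_prop)) (hint (by fun_prop)),
    integral_sub (hint (by fun_prop)) (hint (by fun_prop)), hadv, integral_const_mul,
    integral_const_mul]
  ring
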